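/- Let (X,d) be a compact metric space. Then M(X) equals the supremum of M(F) over all finite subsets F of X; equivalently, M(X) = sup over n, points x₁,…,xₙ ∈ X, and real weights αᵢ with Σαᵢ = 1 of Σᵢⱼ αᵢαⱼ d(xᵢ,xⱼ). -/

import Mathlib

open MeasureTheory

theorem aux_sSup (A B : Set ℝ) (h : B ⊆ A)
    (h2 : ∀ a ∈ A, ∀ ε > 0, ∃ b ∈ B, a - ε ≤ b) : sSup A = sSup B := by
  have hub : upperBounds A = upperBounds B := by
    apply Set.Subset.antisymm
    · exact upperBounds_mono_set h
    · intro u hu a ha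
      apply le_of_forall_pos_le_add
      intro ε hε
      obtain ⟨b, hb, hab⟩ := h2 a ha ε hε
      have := hu hb
      linarith
  rcases Set.eq_empty_or_nonempty A with hA | hA
  · subst hA
    rw [Set.subset_empty_iff.1 h]
  · obtain ⟨a, ha⟩ := hA
    obtain ⟨b, hb, -⟩ := h2 a ha 1 one_pos
    by_cases hbd : BddAbove A
    · have hl := isLUB_csSup ⟨a, ha⟩ hbd
      have hl' : IsLUB B (sSup A) := by
        unfold IsLUB at hl ⊢
        rwa [← hub]
      exact (hl'.csSup_eq ⟨b, hb⟩).symm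
    · have hbd' : ¬ BddAbove B := by
        unfold BddAbove at hbd ⊢
        rwa [← hub]
      rw [Real.sSup_of_not_bddAbove hbd, Real.sSup_of_not_bddAbove hbd']

theorem aux_dirac {X : Type*} [MetricSpace X] [CompactSpace X]
    [MeasurableSpace X] [BorelSpace X] {n : ℕ} (x : Fin n → X) (c : Fin n → ℝ) (f : X → ℝ) :
    ∫ a, f a ∂(∑ k, ENNReal.ofReal (c k) • Measure.dirac (x k))
      = ∑ k, max (c k) 0 * f (x k) := by
  rw [integral_finsetSum_measure]
  · refine Finset.sum_congr rfl fun k _ => ?_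
    rw [integral_smul_measure, integral_dirac, ENNReal.toReal_ofReal']
    rfl
  · intro k _
    apply Integrable.smul_measure _ ENNReal.ofReal_ne_top
    exact integrable_dirac (by simp)

theorem aux_part {X : Type*} [MetricSpace X] [CompactSpace X]
    [MeasurableSpace X] [BorelSpace X] (δ : ℝ) (hδ : 0 < δ) :
    ∃ (n : ℕ) (x : Fin n → X) (g : X → Fin n), Measurable g ∧ ∀ a, dist a (x (g a)) < δ := by
  obtain ⟨t, -, htf, ht⟩ := Metric.finite_approx_of_totallyBounded
    (isCompact_univ (X := X)).totallyBounded δ hδ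
  let e := htf.toFinset.equivFin
  let x : Fin htf.toFinset.card → X := fun k => (e.symm k : X)
  have hx : ∀ a, ∃ k, dist a (x k) < δ := by
    intro a
    have := ht (Set.mem_univ a)
    simp only [Set.mem_iUnion, Metric.mem_ball] at this
    obtain ⟨y, hy, hay⟩ := this
    exact ⟨e ⟨y, by simpa using hy⟩, by simpa [x] using hay⟩
  have hm : ∀ a, ∃ k, dist a (x k) < δ ∧ ∀ j < k, ¬ dist a (x j) < δ := by
    intro a
    obtain ⟨k, hk⟩ := WellFounded.has_min (wellFounded_lt (α := Fin htf.toFinset.card))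
      {k | dist a (x k) < δ} (hx a)
    exact ⟨k, hk.1, fun j hj h => hk.2 j h hj⟩
  choose g hg1 hg2 using hm
  refine ⟨_, x, g, ?_, hg1⟩
  apply measurable_to_countable'
  intro k
  have : g ⁻¹' {k} = {a | dist a (x k) < δ} ∩ ⋂ j, ⋂ (_ : j < k), {a | dist a (x j) < δ}ᶜ := by
    ext a
    simp only [Set.mem_preimage, Set.mem_singleton_iff, Set.mem_inter_iff, Set.mem_iInter,
      Set.mem_compl_iff, Set.mem_ofPred_eq]
    constructor
    · rintro rfl
      exact ⟨hg1 a, hg2 a⟩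
    · rintro ⟨h1, h2⟩
      apply le_antisymm
      · by_contra! h
        exact hg2 a k h h1
      · by_contra! h
        exact h2 _ h (hg1 a)
  rw [this]
  have hb : ∀ j, MeasurableSet {a | dist a (x j) < δ} := fun j =>
    (isOpen_lt (by fun_prop) (by fun_prop)).measurableSet
  exact (hb k).inter (MeasurableSet.iInter fun j => MeasurableSet.iInter fun _ => (hb j).compl)

theorem aux_fin {X : Type*} [MeasurableSpace X] (P : Measure X) [IsFiniteMeasure P]
    {n : ℕ} (g : X → Fin n) (hg : Measurable g) (h : Fin n → ℝ) :
    ∫ a, h (g a) ∂P = ∑ k, P.real (g ⁻¹' {k}) * h k := by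
  have h1 := integral_map (μ := P) hg.aemeasurable (f := h)
    (measurable_of_countable h).aestronglyMeasurable
  rw [← h1, integral_fintype (Integrable.of_finite)]
  refine Finset.sum_congr rfl fun k _ => ?_
  rw [map_measureReal_apply hg (measurableSet_singleton k)]
  rfl

theorem aux_approx {X : Type*} [MetricSpace X] [CompactSpace X]
    [MeasurableSpace X] [BorelSpace X] (δ : ℝ) 
    {n : ℕ} (x : Fin n → X) (g : X → Fin n) (hg : Measurable g)
    (hx : ∀ a, dist a (x (g a)) < δ) (P Q : Measure X) [IsFiniteMeasure P] [IsFiniteMeasure Q] :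
    |(∫ a, ∫ b, dist a b ∂Q ∂P)
      - ∑ k, ∑ l, P.real (g ⁻¹' {k}) * Q.real (g ⁻¹' {l}) * dist (x k) (x l)|
      ≤ 2 * δ * (P.real Set.univ * Q.real Set.univ) := by
  have e : ∑ k, ∑ l, P.real (g ⁻¹' {k}) * Q.real (g ⁻¹' {l}) * dist (x k) (x l)
      = ∫ a, ∫ b, dist (x (g a)) (x (g b)) ∂Q ∂P := by
    have h1 : ∀ a, ∫ b, dist (x (g a)) (x (g b)) ∂Q
        = ∑ l, Q.real (g ⁻¹' {l}) * dist (x (g a)) (x l) := fun a =>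
      aux_fin Q g hg (fun l => dist (x (g a)) (x l))
    simp_rw [h1]
    rw [aux_fin P g hg (fun k => ∑ l, Q.real (g ⁻¹' {l}) * dist (x k) (x l))]
    simp_rw [Finset.mul_sum, mul_assoc]
  have hbd : ∀ a b : X, ‖dist a b‖ ≤ Metric.diam (Set.univ : Set X) := by
    intro a b
    rw [Real.norm_of_nonneg dist_nonneg]
    exact Metric.dist_le_diam_of_mem isCompact_univ.isBounded trivial trivial
  have i1 : Integrable (fun z : X × X => dist z.1 z.2) (P.prod Q) :=
    Integrable.of_bound (by fun_prop) _ (Filter.Eventually.of_forall fun z => hbd _ _)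
  have hxg : Measurable (fun a => x (g a)) := (measurable_of_countable x).comp hg
  have i2 : Integrable (fun z : X × X => dist (x (g z.1)) (x (g z.2))) (P.prod Q) := by
    refine Integrable.of_bound (Measurable.aestronglyMeasurable ?_) _
      (Filter.Eventually.of_forall fun z => hbd _ _)
    exact (hxg.comp measurable_fst).dist (hxg.comp measurable_snd)
  rw [e, ← integral_prod _ i1, ← integral_prod _ i2, ← integral_sub i1 i2]
  refine (norm_integral_le_of_norm_le_const (μ := P.prod Q) (C := 2 * δ)
    (f := fun z : X × X => dist z.1 z.2 - dist (x (g z.1)) (x (g z.2)))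
    (Filter.Eventually.of_forall fun z => ?_)).trans ?_
  · have h1 := hx z.1
    have h2 := hx z.2
    have := dist_dist_dist_le z.1 z.2 (x (g z.1)) (x (g z.2))
    rw [Real.dist_eq] at this
    rw [Real.norm_eq_abs]
    linarith
  · rw [← Set.univ_prod_univ, measureReal_prod_prod]

theorem M_eq_sup_over_finite_subsets
    {X : Type*} [MetricSpace X] [CompactSpace X]
    [MeasurableSpace X] [BorelSpace X] :
    sSup {r : ℝ | ∃ P N : Measure X, IsFiniteMeasure P ∧ IsFiniteMeasure N ∧
        (P Set.univ).toReal - (N Set.univ).toReal = 1 ∧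
        r = (∫ a, ∫ b, dist a b ∂P ∂P) + (∫ a, ∫ b, dist a b ∂N ∂N)
              - 2 * (∫ a, ∫ b, dist a b ∂N ∂P)}
      = sSup {r : ℝ | ∃ (n : ℕ) (x : Fin n → X) (α : Fin n → ℝ),
          (∑ k, α k) = 1 ∧ r = ∑ k, ∑ l, α k * α l * dist (x k) (x l)} := by
  -- symmetry of the finite energy, used in both directions
  have key : ∀ (n : ℕ) (x : Fin n → X) (p q : Fin n → ℝ),
      ∑ k, ∑ l, (p k - q k) * (p l - q l) * dist (x k) (x l)
      = (∑ k, ∑ l, p k * p l * dist (x k) (x l)) + (∑ k, ∑ l, q k * q l * dist (x k) (x l))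
        - 2 * ∑ k, ∑ l, p k * q l * dist (x k) (x l) := by
    intro n x p q
    have hs : ∑ k, ∑ l, p k * q l * dist (x k) (x l)
        = ∑ k, ∑ l, q k * p l * dist (x k) (x l) := by
      rw [Finset.sum_comm]
      refine Finset.sum_congr rfl fun k _ => Finset.sum_congr rfl fun l _ => ?_
      rw [dist_comm]; ring
    rw [two_mul]
    nth_rewrite 2 [hs]
    simp only [← Finset.sum_add_distrib, ← Finset.sum_sub_distrib]
    refine Finset.sum_congr rfl fun k _ => Finset.sum_congr rfl fun l _ => ?_
    ring
  apply aux_sSup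
  · rintro r ⟨n, x, α, hα, rfl⟩
    have hm : ∀ t : ℝ, t = max t 0 - max (-t) 0 := by
      intro t
      rcases le_total t 0 with h | h
      · rw [max_eq_right h, max_eq_left (by linarith)]; ring
      · rw [max_eq_left h, max_eq_right (by linarith)]; ring
    refine ⟨∑ k, ENNReal.ofReal (α k) • Measure.dirac (x k),
      ∑ k, ENNReal.ofReal (-α k) • Measure.dirac (x k), ?_, ?_, ?_, ?_⟩
    · constructor
      simp [Measure.finsetSum_apply]
    · constructor
      simp [Measure.finsetSum_apply]
    · rw [Measure.finsetSum_apply, Measure.finsetSum_apply,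
        ENNReal.toReal_sum (by simp), ENNReal.toReal_sum (by simp), ← Finset.sum_sub_distrib, ← hα]
      refine Finset.sum_congr rfl fun k _ => ?_
      simp [ENNReal.toReal_ofReal', ← hm]
    · simp only [aux_dirac, aux_dirac x (fun k => -α k)]
      have := key n x (fun k => max (α k) 0) (fun k => max (-α k) 0)
      simp only [← hm] at this
      rw [this]
      simp_rw [Finset.mul_sum, mul_assoc]
  · rintro r ⟨P, N, hP, hN, h1, rfl⟩ ε hε
    set p := P.real Set.univ with hp
    set q := N.real Set.univ with hq
    have hp0 : 0 ≤ p := measureReal_nonneg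
    have hq0 : 0 ≤ q := measureReal_nonneg
    have hD : 0 < 2 * (p + q) ^ 2 + 1 := by positivity
    obtain ⟨n, x, g, hg, hx⟩ := aux_part (X := X) (ε / (2 * (p + q) ^ 2 + 1)) (by positivity)
    set δ := ε / (2 * (p + q) ^ 2 + 1) with hδ
    have hδ0 : 0 < δ := by positivity
    have hδe : δ * (2 * (p + q) ^ 2 + 1) = ε := div_mul_cancel₀ _ hD.ne'
    have a1 := abs_le.1 (aux_approx δ x g hg hx P P)
    have a2 := abs_le.1 (aux_approx δ x g hg hx N N)
    have a3 := abs_le.1 (aux_approx δ x g hg hx P N)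
    refine ⟨_, ⟨n, x, fun k => P.real (g ⁻¹' {k}) - N.real (g ⁻¹' {k}), ?_, rfl⟩, ?_⟩
    · have s : ∀ (Q : Measure X) [IsFiniteMeasure Q],
          ∑ k, Q.real (g ⁻¹' {k}) = (Q Set.univ).toReal := by
        intro Q _
        have := aux_fin Q g hg (fun _ => 1)
        simp only [mul_one] at this
        rw [← this]
        simp [Measure.real]
      rw [Finset.sum_sub_distrib, s P, s N, h1]
    · rw [key]
      rw [← hp] at a1 a3
      rw [← hq] at a2 a3
      nlinarith [a1.1, a1.2, a2.1, a2.2, a3.1, a3.2]
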